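/- Let q : [0,∞) → ℝ be continuous and satisfy the Kamenev condition for some ε > 2 and t₀ > 0. Then every solution x of the differential equation (x'/√(1+(x')²))'(t) + q(t)x(t) = 0 for t > 0 that does not vanish identically on any neighborhood of +∞ oscillates: for every T > 0 there exist t₁, t₂ > T with x(t₁) < 0 and x(t₂) > 0. -/

import Mathlib

open Real MeasureTheory Filter

/-- The Caputo fractional derivative of order `α` of `h` at `t`:
`h^(α)(t) = (1/Γ(1−α)) ∫₀ᵗ h'(s) (t−s)^(−α) ds`. -/
noncomputable def caputoDeriv (α : ℝ) (h : ℝ → ℝ) (t : ℝ) : ℝ :=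
  (1 / Real.Gamma (1 - α)) * ∫ s in (0:ℝ)..t, deriv h s / (t - s) ^ α

/-- Kamenev condition: `limsup_{t→+∞} t^(−ε) ∫_{t₀}^t (t−s)^ε q(s) ds = +∞`. -/
def KamenevCondition (q : ℝ → ℝ) (ε t₀ : ℝ) : Prop :=
  ∀ M : ℝ, ∃ᶠ t in atTop, M < (1 / t ^ ε) * ∫ s in t₀..t, (t - s) ^ ε * q s

/-- The mean-curvature-type operator `(𝒟x)(t) = x'(t)/√(1+(x'(t))²)`. -/
noncomputable def curvOp (x : ℝ → ℝ) (t : ℝ) : ℝ :=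
  deriv x t / Real.sqrt (1 + (deriv x t) ^ 2)

/-- Uniqueness: a solution with `x s = 0` and `x' s = 0` vanishes on `[s, ∞)`. -/
lemma kam_vanish
    (q : ℝ → ℝ) (hq : ContinuousOn q (Set.Ici (0:ℝ)))
    (x : ℝ → ℝ) (hd : ∀ t > (0:ℝ), HasDerivAt x (deriv x t) t)
    (hc : ContinuousOn (deriv x) (Set.Ioi (0:ℝ)))
    (heq : ∀ t > (0:ℝ), HasDerivAt (curvOp x) (-(q t * x t)) t)
    (s : ℝ) (hs : 0 < s) (h0 : x s = 0) (h1 : deriv x s = 0) (b : ℝ) (hb : s ≤ b) :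
    x b = 0 := by
  have hsub : Set.Icc s b ⊆ Set.Ioi (0:ℝ) := fun t ht => lt_of_lt_of_le hs ht.1
  have hcont : ContinuousOn (fun t => Real.sqrt (1 + (deriv x t) ^ 2) + |q t|) (Set.Icc s b) := by
    have h2 := hc.mono hsub
    have h3 : ContinuousOn q (Set.Icc s b) := hq.mono fun t ht => Set.Ioi_subset_Ici_self (hsub ht)
    exact ((continuousOn_const.add (h2.pow 2)).sqrt).add h3.abs
  obtain ⟨K, hK⟩ := isCompact_Icc.bddAbove_image hcont
  have hK' : ∀ t ∈ Set.Icc s b, Real.sqrt (1 + (deriv x t) ^ 2) + |q t| ≤ K :=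
    fun t ht => hK (Set.mem_image_of_mem _ ht)
  let F : ℝ → ℝ := fun t => (x t ^ 2 + curvOp x t ^ 2) * Real.exp (-(K * t))
  have hF : ∀ t > (0:ℝ), HasDerivAt F
      ((2 * x t * deriv x t + 2 * curvOp x t * (-(q t * x t))) * Real.exp (-(K * t))
        + (x t ^ 2 + curvOp x t ^ 2) * (Real.exp (-(K * t)) * (-K))) t := by
    intro t ht
    have e1 := ((hd t ht).pow 2).add ((heq t ht).pow 2)
    have e2 : HasDerivAt (fun t : ℝ => Real.exp (-(K * t))) (Real.exp (-(K * t)) * (-K)) t := by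
      have := ((hasDerivAt_id t).const_mul K).neg.exp
      simpa using this
    have e3 := e1.mul e2
    refine e3.congr_deriv ?_
    simp
  have hanti : AntitoneOn F (Set.Icc s b) := by
    apply antitoneOn_of_deriv_nonpos (convex_Icc s b)
    · intro t ht
      exact (hF t (hsub ht)).continuousAt.continuousWithinAt
    · intro t ht
      rw [interior_Icc] at ht
      exact (hF t (hsub (Set.Ioo_subset_Icc_self ht))).differentiableAt.differentiableWithinAt
    · intro t ht
      rw [interior_Icc] at ht
      have ht' := Set.Ioo_subset_Icc_self ht
      rw [(hF t (hsub ht')).deriv]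
      have hk := hK' t ht'
      have hS : 0 < Real.sqrt (1 + (deriv x t) ^ 2) := Real.sqrt_pos.2 (by positivity)
      have hy : deriv x t = curvOp x t * Real.sqrt (1 + (deriv x t) ^ 2) := by
        unfold curvOp; field_simp
      set S := Real.sqrt (1 + (deriv x t) ^ 2) with hSdef
      set y := curvOp x t
      have hfac : 2 * x t * deriv x t + 2 * y * (-(q t * x t)) - K * (x t ^ 2 + y ^ 2) ≤ 0 := by
        rw [hy]
        have h5 : 2 * (x t * y) * (S - q t) ≤ |2 * (x t * y)| * |S - q t| := by
          rw [← abs_mul]; exact le_abs_self _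
        have h6 : |S - q t| ≤ K := by
          calc |S - q t| ≤ |S| + |q t| := abs_sub _ _
            _ ≤ K := by rw [abs_of_pos hS]; exact hk
        have h7 : |2 * (x t * y)| ≤ x t ^ 2 + y ^ 2 := by
          rw [abs_le]; constructor <;> nlinarith [sq_nonneg (x t - y), sq_nonneg (x t + y)]
        have h8 : |2 * (x t * y)| * |S - q t| ≤ (x t ^ 2 + y ^ 2) * K := by gcongr
        nlinarith
      have := mul_nonpos_of_nonpos_of_nonneg hfac (Real.exp_pos (-(K * t))).le
      nlinarith
  have hle := hanti (Set.left_mem_Icc.2 hb) (Set.right_mem_Icc.2 hb) hb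
  have hFs : F s = 0 := by simp [F, curvOp, h0, h1]
  rw [hFs] at hle
  have h9 : x b ^ 2 + curvOp x b ^ 2 ≤ 0 := by
    by_contra hcon
    push Not at hcon
    have := mul_pos hcon (Real.exp_pos (-(K * b)))
    exact absurd hle (not_le.2 this)
  have : x b ^ 2 = 0 := by nlinarith [sq_nonneg (x b), sq_nonneg (curvOp x b)]
  exact pow_eq_zero_iff (two_ne_zero) |>.1 this

/-- Riccati estimate for a positive solution. -/
lemma kam_riccati
    (ε : ℝ) (hε : 2 < ε)
    (q : ℝ → ℝ) (hq : ContinuousOn q (Set.Ici (0:ℝ)))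
    (x : ℝ → ℝ) (hd : ∀ t > (0:ℝ), HasDerivAt x (deriv x t) t)
    (heq : ∀ t > (0:ℝ), HasDerivAt (curvOp x) (-(q t * x t)) t)
    (a : ℝ) (ha : 0 < a) (hpos : ∀ t ≥ a, 0 < x t) (t : ℝ) (hat : a ≤ t) :
    ∫ s in a..t, (t - s) ^ ε * q s ≤
      (t - a) ^ ε * (curvOp x a / x a) + ε ^ 2 / (4 * (ε - 1)) * (t - a) ^ (ε - 1) := by
  let w : ℝ → ℝ := fun s => curvOp x s / x s
  let G : ℝ → ℝ := fun s => -((t - s) ^ ε * w s) - ε ^ 2 / (4 * (ε - 1)) * (t - s) ^ (ε - 1)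
  have hw : ∀ s ≥ a, HasDerivAt w
      ((-(q s * x s) * x s - curvOp x s * deriv x s) / x s ^ 2) s := fun s hs =>
    (heq s (ha.trans_le hs)).div (hd s (ha.trans_le hs)) (hpos s hs).ne'
  have hpow : ∀ p > (0:ℝ), Continuous fun s : ℝ => (t - s) ^ p := fun p hp =>
    (continuous_const.sub continuous_id).rpow_const fun _ => Or.inr hp.le
  have hdp : ∀ p : ℝ, ∀ s < t, HasDerivAt (fun s : ℝ => (t - s) ^ p) (-(p * (t - s) ^ (p - 1))) s := by
    intro p s hs
    have h1 : HasDerivAt (fun s : ℝ => t - s) (-1) s := by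
      simpa using (hasDerivAt_id s).const_sub t
    refine (h1.rpow_const (p := p) (Or.inl (sub_pos.2 hs).ne')).congr_deriv ?_
    ring
  have hGc : ContinuousOn G (Set.Icc a t) := by
    have hwc : ContinuousOn w (Set.Icc a t) := fun s hs =>
      (hw s hs.1).continuousAt.continuousWithinAt
    exact (((hpow ε (by linarith)).continuousOn.mul hwc).neg).sub
      (continuousOn_const.mul (hpow (ε - 1) (by linarith)).continuousOn)
  have hGd : ∀ s ∈ Set.Ioo a t, HasDerivAt G
      (-(-(ε * (t - s) ^ (ε - 1)) * w s + (t - s) ^ ε *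
        ((-(q s * x s) * x s - curvOp x s * deriv x s) / x s ^ 2)) -
        ε ^ 2 / (4 * (ε - 1)) * (-((ε - 1) * (t - s) ^ (ε - 1 - 1)))) s := by
    intro s hs
    exact (((hdp ε s hs.2).mul (hw s hs.1.le)).neg).sub ((hdp (ε - 1) s hs.2).const_mul _)
  have hintg : IntegrableOn (fun s => (t - s) ^ ε * q s) (Set.Icc a t) := by
    apply ContinuousOn.integrableOn_Icc
    exact (hpow ε (by linarith)).continuousOn.mul
      (hq.mono fun s hs => ha.le.trans hs.1)
  have hmain := intervalIntegral.integral_le_sub_of_hasDeriv_right_of_le hat hGc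
    (fun s hs => (hGd s hs).hasDerivWithinAt) hintg ?_
  · have hGt : G t = 0 := by
      simp only [G, sub_self]
      rw [Real.zero_rpow (by linarith), Real.zero_rpow (by linarith)]; ring
    rw [hGt] at hmain
    simp only [G, w] at hmain
    linarith
  · intro s hs
    have hu : 0 < t - s := sub_pos.2 hs.2
    have hx := hpos s hs.1.le
    have hU := Real.rpow_pos_of_pos hu (ε - 1 - 1)
    have e1 : (t - s) ^ (ε - 1) = (t - s) ^ (ε - 1 - 1) * (t - s) := by
      rw [← Real.rpow_add_one hu.ne']; ring_nf
    have e2 : (t - s) ^ ε = (t - s) ^ (ε - 1 - 1) * (t - s) * (t - s) := by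
      rw [← e1, ← Real.rpow_add_one hu.ne']; ring_nf
    have hS : 1 ≤ Real.sqrt (1 + (deriv x s) ^ 2) := by
      rw [Real.one_le_sqrt]; nlinarith [sq_nonneg (deriv x s)]
    have hy : deriv x s = curvOp x s * Real.sqrt (1 + (deriv x s) ^ 2) := by
      unfold curvOp; field_simp
    have hyx : curvOp x s ^ 2 ≤ curvOp x s * deriv x s := by
      rw [hy]
      nlinarith [mul_nonneg (sq_nonneg (curvOp x s)) (sub_nonneg.2 hS)]
    have hwq : (-(q s * x s) * x s - curvOp x s * deriv x s) / x s ^ 2 ≤ -q s - w s ^ 2 := by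
      rw [div_le_iff₀ (by positivity)]
      have : w s * x s = curvOp x s := by simp only [w]; field_simp
      rw [← this] at hyx ⊢
      nlinarith
    rw [e1, e2]
    set U := (t - s) ^ (ε - 1 - 1)
    set u := t - s
    have e3 : ε ^ 2 / (4 * (ε - 1)) * (-((ε - 1) * U)) = - (ε ^ 2 / 4 * U) := by
      have : ε - 1 ≠ 0 := by linarith
      field_simp
    rw [e3]
    have h10 := mul_le_mul_of_nonneg_left hwq (by positivity : 0 ≤ U * u * u)
    have h11 : 0 ≤ U * (u * w s + ε / 2) ^ 2 := by positivity
    nlinarith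

lemma kam_core
    (ε t₀ : ℝ) (hε : 2 < ε) (ht₀ : 0 < t₀)
    (q : ℝ → ℝ) (hq : ContinuousOn q (Set.Ici (0:ℝ)))
    (hK : KamenevCondition q ε t₀)
    (x : ℝ → ℝ) (hx : ContDiffOn ℝ 1 x (Set.Ici (0:ℝ)))
    (heq : ∀ t > (0:ℝ), HasDerivAt (curvOp x) (-(q t * x t)) t)
    (hnt : ∀ T > (0:ℝ), ∃ t > T, x t ≠ 0) :
    ∀ T > (0:ℝ), ∃ t₁ > T, x t₁ < 0 := by
  intro T hT
  by_contra hcon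
  push Not at hcon
  have hx' : ContDiffOn ℝ 1 x (Set.Ioi (0:ℝ)) := hx.mono Set.Ioi_subset_Ici_self
  have hd : ∀ t > (0:ℝ), HasDerivAt x (deriv x t) t := fun t ht =>
    ((hx'.differentiableOn one_ne_zero).differentiableAt (Ioi_mem_nhds ht)).hasDerivAt
  have hc : ContinuousOn (deriv x) (Set.Ioi (0:ℝ)) :=
    hx'.continuousOn_deriv_of_isOpen isOpen_Ioi le_rfl
  have hpos : ∀ t > T, 0 < x t := by
    intro s hs
    refine lt_of_le_of_ne (hcon s hs) fun h0 => ?_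
    have hmin : IsLocalMin x s := by
      filter_upwards [Ioi_mem_nhds hs] with r hr
      rw [← h0]; exact hcon r hr
    obtain ⟨b, hb, hb'⟩ := hnt s (hT.trans hs)
    exact hb' (kam_vanish q hq x hd hc heq s (hT.trans hs) h0.symm hmin.deriv_eq_zero b hb.le)
  set a := max (T + 1) t₀ with hadef
  have haT : T < a := lt_of_lt_of_le (by linarith) (le_max_left _ _)
  have hat₀ : t₀ ≤ a := le_max_right _ _
  have ha : 0 < a := hT.trans haT
  have hR := kam_riccati ε hε q hq x hd heq a ha fun t ht => hpos t (haT.trans_le ht)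
  have hfr := hK ((∫ s in t₀..a, |q s|) + |curvOp x a / x a| + ε ^ 2 / (4 * (ε - 1)))
  obtain ⟨t, hMt, htge⟩ := (hfr.and_eventually (eventually_ge_atTop (max a 1))).exists
  have hta : a ≤ t := (le_max_left _ _).trans htge
  have ht1 : 1 ≤ t := (le_max_right _ _).trans htge
  have ht0 : 0 < t := by linarith
  have hP : 0 < t ^ ε := Real.rpow_pos_of_pos ht0 ε
  have hpc : Continuous fun s : ℝ => (t - s) ^ ε :=
    (continuous_const.sub continuous_id).rpow_const fun _ => Or.inr (by linarith)
  have hqi : ∀ c d : ℝ, 0 ≤ c → c ≤ d → ContinuousOn q (Set.uIcc c d) := by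
    intro c d hc0 hcd
    rw [Set.uIcc_of_le hcd]
    exact hq.mono fun s hs => hc0.trans hs.1
  have hi1 : IntervalIntegrable (fun s => (t - s) ^ ε * q s) volume t₀ a :=
    (hpc.continuousOn.mul (hqi t₀ a ht₀.le hat₀)).intervalIntegrable
  have hi2 : IntervalIntegrable (fun s => (t - s) ^ ε * q s) volume a t :=
    (hpc.continuousOn.mul (hqi a t ha.le hta)).intervalIntegrable
  have hsplit := intervalIntegral.integral_add_adjacent_intervals hi1 hi2
  have hfirst : ∫ s in t₀..a, (t - s) ^ ε * q s ≤ t ^ ε * ∫ s in t₀..a, |q s| := by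
    rw [← intervalIntegral.integral_const_mul]
    apply intervalIntegral.integral_mono_on hat₀ hi1
    · exact (continuousOn_const.mul (hqi t₀ a ht₀.le hat₀).abs).intervalIntegrable
    · intro s hs
      have h1 : (0:ℝ) ≤ t - s := by linarith [hs.2]
      have h2 : (t - s) ^ ε ≤ t ^ ε :=
        Real.rpow_le_rpow h1 (by linarith [hs.1]) (by linarith)
      have h3 := Real.rpow_nonneg h1 ε
      calc (t - s) ^ ε * q s ≤ (t - s) ^ ε * |q s| := by gcongr; exact le_abs_self _
        _ ≤ t ^ ε * |q s| := by gcongr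
  have hsecond := hR t hta
  have h1 : (0:ℝ) ≤ t - a := by linarith
  have h2 : (t - a) ^ ε * (curvOp x a / x a) ≤ t ^ ε * |curvOp x a / x a| := by
    have h3 := Real.rpow_nonneg h1 ε
    have h4 : (t - a) ^ ε ≤ t ^ ε := Real.rpow_le_rpow h1 (by linarith) (by linarith)
    calc (t - a) ^ ε * (curvOp x a / x a) ≤ (t - a) ^ ε * |curvOp x a / x a| := by
          gcongr; exact le_abs_self _
      _ ≤ _ := by gcongr
  have h5 : (t - a) ^ (ε - 1) ≤ t ^ ε :=
    (Real.rpow_le_rpow h1 (by linarith) (by linarith)).trans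
      (Real.rpow_le_rpow_of_exponent_le ht1 (by linarith))
  have h6 : 0 ≤ ε ^ 2 / (4 * (ε - 1)) := div_nonneg (sq_nonneg _) (by linarith)
  have h7 := mul_le_mul_of_nonneg_left h5 h6
  rw [one_div, ← div_eq_inv_mul, lt_div_iff₀ hP] at hMt
  nlinarith

theorem kamenev_oscillation_mean_curvature_equation
    (ε t₀ : ℝ) (hε : 2 < ε) (ht₀ : 0 < t₀)
    (q : ℝ → ℝ) (hq : ContinuousOn q (Set.Ici (0:ℝ)))
    (hK : KamenevCondition q ε t₀)
    (x : ℝ → ℝ) (hx : ContDiffOn ℝ 1 x (Set.Ici (0:ℝ)))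
    (heq : ∀ t > (0:ℝ), HasDerivAt (curvOp x) (-(q t * x t)) t)
    (hnt : ∀ T > (0:ℝ), ∃ t > T, x t ≠ 0) :
    ∀ T > (0:ℝ), (∃ t₁ > T, x t₁ < 0) ∧ ∃ t₂ > T, 0 < x t₂ := by
  intro T hT
  refine ⟨kam_core ε t₀ hε ht₀ q hq hK x hx heq hnt T hT, ?_⟩
  have hcurv : curvOp (fun t => -x t) = fun t => -curvOp x t := by
    funext t
    simp only [curvOp, deriv.fun_neg]
    rw [neg_sq, neg_div]
  obtain ⟨t, ht, h⟩ := kam_core ε t₀ hε ht₀ q hq hK (fun t => -x t) hx.neg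
    (fun t ht => by
      rw [hcurv]
      refine (heq t ht).neg.congr_deriv ?_
      ring)
    (fun T hT => by
      obtain ⟨t, ht, h⟩ := hnt T hT
      exact ⟨t, ht, neg_ne_zero.2 h⟩) T hT
  exact ⟨t, ht, by simpa using h⟩
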